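/- Let G be an abelian group generated by elements g_1, …, g_n. Then every Fricke character tr x, for x ∈ G, lies in the ℚ-subalgebra of F(R(G),ℂ) generated by the n + n(n−1)/2 elements tr g_i (1 ≤ i ≤ n) and tr(g_i g_j) (1 ≤ i < j ≤ n). Equivalently, the ℚ-algebra homomorphism π̄ from the polynomial ring ℚ[t_i (1 ≤ i ≤ n), t_{ij} (1 ≤ i < j ≤ n)] to F(R(G),ℂ) defined by π̄(t_i) = tr g_i, π̄(t_{ij}) = tr(g_i g_j) maps onto 𝔛_ℚ(G). -/

import Mathlib

set_option synthInstance.maxHeartbeats 1000000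
set_option maxHeartbeats 1000000

noncomputable section

abbrev SL2 : Type := Matrix.SpecialLinearGroup (Fin 2) ℂ

/-- The Fricke character `tr x ∈ F(R(G),ℂ)` of an element `x` of a group `G`. -/
def trG {G : Type*} [Group G] (x : G) : (G →* SL2) → ℂ :=
  fun ρ => Matrix.trace ((ρ x : Matrix (Fin 2) (Fin 2) ℂ))

theorem trG_one {G : Type*} [Group G] : trG (1 : G) = 2 := by
  funext ρ
  simp [trG]

theorem trG_mul_add_trG_mul_inv {G : Type*} [Group G] (x y : G) :
    trG (x * y) + trG (x * y⁻¹) = trG x * trG y := by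
  funext ρ
  simp only [trG, Pi.add_apply, Pi.mul_apply, map_mul, map_inv, Matrix.SpecialLinearGroup.coe_mul,
    Matrix.SpecialLinearGroup.coe_inv, Matrix.adjugate_fin_two, Matrix.trace_fin_two,
    Matrix.mul_apply, Fin.sum_univ_two, Matrix.of_apply, Matrix.cons_val', Matrix.cons_val_zero,
    Matrix.cons_val_one, Matrix.cons_val_fin_one]
  ring

theorem trG_mul_inv {G : Type*} [Group G] (x y : G) :
    trG (x * y⁻¹) = trG x * trG y - trG (x * y) :=
  eq_sub_of_add_eq' (trG_mul_add_trG_mul_inv x y)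

theorem trG_mul_self {G : Type*} [Group G] (x : G) : trG (x * x) = trG x * trG x - 2 := by
  have h := trG_mul_add_trG_mul_inv x x
  rw [mul_inv_cancel, trG_one] at h
  exact eq_sub_of_add_eq h

/-- In a commutative group, the character of a product of three elements is determined by the
characters of the factors and of their pairwise products. -/
theorem two_mul_trG_mul_mul {G : Type*} [CommGroup G] (x y z : G) :
    2 * trG (x * y * z) = trG x * trG (y * z) + trG y * trG (x * z) + trG z * trG (x * y)
      - trG x * trG y * trG z := by
  have h₁ := trG_mul_add_trG_mul_inv (y * z) x
  have h₂ := trG_mul_add_trG_mul_inv (x * z) y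
  have h₃ := trG_mul_add_trG_mul_inv x y
  have h₄ := trG_mul_add_trG_mul_inv (x * y⁻¹) z
  have h₅ := trG_mul_add_trG_mul_inv 1 (x * y⁻¹ * z⁻¹)
  rw [one_mul, one_mul, trG_one, show (x * y⁻¹ * z⁻¹)⁻¹ = y * z * x⁻¹ by
    simp [mul_left_comm, mul_assoc]] at h₅
  rw [show y * z * x = x * y * z by ac_rfl] at h₁
  rw [show x * z * y = x * y * z by ac_rfl, show x * z * y⁻¹ = x * y⁻¹ * z by ac_rfl] at h₂
  linear_combination h₁ + h₂ - trG z * h₃ - h₄ - h₅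

/-- **The abelian Horowitz theorem**: if an abelian group `G` is generated by `g_1, …, g_n`,
then every Fricke character `tr x`, `x ∈ G`, lies in the ℚ-subalgebra of `F(R(G),ℂ)` generated
by the `n + n(n-1)/2` characters `tr g_i` (`1 ≤ i ≤ n`) and `tr(g_i g_j)` (`1 ≤ i < j ≤ n`);
equivalently, `π̄ : 𝒫 → 𝔛_ℚ(G)` is surjective. -/
theorem trG_mem_adjoin_of_generates_comm {G : Type*} [CommGroup G] (n : ℕ) (g : Fin n → G)
    (hg : Subgroup.closure (Set.range g) = ⊤) (x : G) :
    trG x ∈ Algebra.adjoin ℚ {f : (G →* SL2) → ℂ |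
      (∃ i : Fin n, f = trG (g i)) ∨
      (∃ i j : Fin n, i < j ∧ f = trG (g i * g j))} := by
  set A := Algebra.adjoin ℚ {f : (G →* SL2) → ℂ |
      (∃ i : Fin n, f = trG (g i)) ∨ (∃ i j : Fin n, i < j ∧ f = trG (g i * g j))}
  have two_mem : (2 : (G →* SL2) → ℂ) ∈ A := ofNat_mem A 2
  have gen_mem (i : Fin n) : trG (g i) ∈ A := Algebra.subset_adjoin (Or.inl ⟨i, rfl⟩)
  have pair_mem (i j : Fin n) : trG (g i * g j) ∈ A := by
    rcases lt_trichotomy i j with h | rfl | h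
    · exact Algebra.subset_adjoin (Or.inr ⟨i, j, h, rfl⟩)
    · rw [trG_mul_self]
      exact sub_mem (mul_mem (gen_mem i) (gen_mem i)) two_mem
    · rw [mul_comm]
      exact Algebra.subset_adjoin (Or.inr ⟨j, i, h, rfl⟩)
  have triple_mem (y : G) (hy : trG y ∈ A) (hyg : ∀ i, trG (y * g i) ∈ A) (i j : Fin n) :
      trG (y * g i * g j) ∈ A := by
    have h : trG (y * g i * g j) = (2⁻¹ : ℚ) • (2 * trG (y * g i * g j)) := by
      rw [two_mul, ← two_smul ℚ, smul_smul]
      norm_num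
    rw [h, two_mul_trG_mul_mul]
    exact A.smul_mem (sub_mem (add_mem (add_mem (mul_mem hy (pair_mem i j))
      (mul_mem (gen_mem i) (hyg j))) (mul_mem (gen_mem j) (hyg i)))
      (mul_mem (mul_mem hy (gen_mem i)) (gen_mem j))) _
  have hx : x ∈ Subgroup.closure (Set.range g) := hg ▸ Subgroup.mem_top x
  suffices h : trG x ∈ A ∧ ∀ i, trG (x * g i) ∈ A from h.1
  induction hx using Subgroup.closure_induction_right with
  | one => exact ⟨trG_one (G := G) ▸ two_mem, fun i => by simpa using gen_mem i⟩
  | mul_right y _ z hz ih =>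
    obtain ⟨j, rfl⟩ := hz
    exact ⟨ih.2 j, triple_mem y ih.1 ih.2 j⟩
  | mul_inv_cancel y _ z hz ih =>
    obtain ⟨j, rfl⟩ := hz
    refine ⟨?_, fun i => ?_⟩
    · rw [trG_mul_inv]
      exact sub_mem (mul_mem ih.1 (gen_mem j)) (ih.2 j)
    · rw [mul_right_comm, trG_mul_inv]
      exact sub_mem (mul_mem (ih.2 i) (gen_mem j)) (triple_mem y ih.1 ih.2 i j)
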